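/- arXiv:1909.09345 — 2 statements merged into one kernel-verified Lean document; each statement's English description precedes it below -/
import Mathlib

section
/- Let p ≥ 1, let λ = (λ₁,…,λ_p) be nonincreasing nonnegative weights, and let x ∈ ℝ^p have exactly k nonzero entries (1 ≤ k ≤ p) whose absolute values are pairwise distinct. Then for every fixed χ ≥ 0, lim_{σ → 0⁺} (1/p) E‖η(x/σ + h; χ, λ) − x/σ‖₂² = k/p + (χ²/p) Σ_{i=1}^k λ_i² + (1/p) E‖η(h̃; χ, λ_{[k+1:p]})‖₂², where λ_{[k+1:p]} = (λ_{k+1},…,λ_p), h̃ is a standard Gaussian vector in ℝ^{p−k}, and the last expectation is 0 when k = p. -/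
open MeasureTheory ProbabilityTheory Filter

/-- Standard Gaussian measure `N(0, I_n)` on `ℝⁿ`. -/
noncomputable def stdGaussian (n : ℕ) : Measure (Fin n → ℝ) :=
  Measure.pi fun _ => gaussianReal 0 1

/-- The nonincreasing rearrangement of the absolute values of the entries of `x`. -/
noncomputable def sortedAbs {n : ℕ} (x : Fin n → ℝ) : Fin n → ℝ :=
  fun i => |x ((Tuple.sort fun j => -|x j|) i)|

/-- The sorted-ℓ1 (SLOPE) norm `‖x‖_λ = ∑ λ_i |x|_(i)`. -/
noncomputable def slopeNorm {n : ℕ} (lam x : Fin n → ℝ) : ℝ :=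
  ∑ i, lam i * sortedAbs x i

/-- The SLOPE proximal objective `½‖u − v‖₂² + γ‖v‖_λ`. -/
noncomputable def slopeObj {n : ℕ} (lam : Fin n → ℝ) (γ : ℝ) (u v : Fin n → ℝ) : ℝ :=
  (1/2) * ∑ i, (u i - v i)^2 + γ * slopeNorm lam v

/-- `v` is a minimizer of the SLOPE proximal objective, i.e. `v = η(u; γ, λ)`
(the minimizer is unique since the objective is strictly convex). -/
def IsSlopeProx {n : ℕ} (lam : Fin n → ℝ) (γ : ℝ) (u v : Fin n → ℝ) : Prop :=
  ∀ w, slopeObj lam γ u v ≤ slopeObj lam γ u w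

section SlopeNorm

variable {n : ℕ} {lam : Fin n → ℝ}

theorem antitone_sortedAbs (x : Fin n → ℝ) : Antitone (sortedAbs x) := fun i j hij => by
  have := Tuple.monotone_sort (fun j => -|x j|) hij
  simpa [sortedAbs] using this

/-- The sorted-ℓ1 norm dominates every weighted ℓ1 norm with permuted weights. -/
theorem sum_mul_abs_comp_perm_le_slopeNorm (hlam : Antitone lam) (π : Equiv.Perm (Fin n))
    (x : Fin n → ℝ) : ∑ i, lam i * |x (π i)| ≤ slopeNorm lam x := by
  have h := (hlam.monovary (antitone_sortedAbs x)).sum_mul_comp_perm_le_sum_mul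
    (σ := (Tuple.sort fun j => -|x j|)⁻¹ * π)
  simpa [sortedAbs, slopeNorm] using h

theorem slopeNorm_eq_sum_of_antitone (hlam : Antitone lam) {π : Equiv.Perm (Fin n)}
    {x : Fin n → ℝ} (hx : Antitone fun i => |x (π i)|) :
    slopeNorm lam x = ∑ i, lam i * |x (π i)| := by
  refine le_antisymm ?_ (sum_mul_abs_comp_perm_le_slopeNorm hlam π x)
  have h := (hlam.monovary hx).sum_mul_comp_perm_le_sum_mul
    (σ := π⁻¹ * Tuple.sort fun j => -|x j|)
  simpa [sortedAbs, slopeNorm] using h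

theorem slopeNorm_comp_perm (hlam : Antitone lam) (π : Equiv.Perm (Fin n)) (x : Fin n → ℝ) :
    slopeNorm lam (fun i => x (π i)) = slopeNorm lam x := by
  symm
  exact slopeNorm_eq_sum_of_antitone hlam
    (π := π * Tuple.sort fun j => -|x (π j)|) (antitone_sortedAbs fun i => x (π i))

theorem slopeNorm_segment_le (hlam : Antitone lam) (h0 : ∀ i, 0 ≤ lam i) (v w : Fin n → ℝ)
    {t : ℝ} (ht0 : 0 ≤ t) (ht1 : t ≤ 1) :
    slopeNorm lam (fun i => v i + t * (w i - v i)) ≤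
      (1 - t) * slopeNorm lam v + t * slopeNorm lam w := by
  set z : Fin n → ℝ := fun i => v i + t * (w i - v i) with hz
  set π := Tuple.sort fun j => -|z j|
  have hv := mul_le_mul_of_nonneg_left
    (sum_mul_abs_comp_perm_le_slopeNorm hlam π v) (sub_nonneg.2 ht1)
  have hw := mul_le_mul_of_nonneg_left (sum_mul_abs_comp_perm_le_slopeNorm hlam π w) ht0
  refine le_trans ?_ (add_le_add hv hw)
  rw [Finset.mul_sum, Finset.mul_sum, ← Finset.sum_add_distrib]
  refine Finset.sum_le_sum fun i _ => ?_
  have habs : |z (π i)| ≤ (1 - t) * |v (π i)| + t * |w (π i)| := by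
    have : z (π i) = (1 - t) * v (π i) + t * w (π i) := by simp only [hz]; ring
    rw [this]
    refine (abs_add_le _ _).trans_eq ?_
    rw [abs_mul, abs_mul, abs_of_nonneg ht0, abs_of_nonneg (sub_nonneg.2 ht1)]
  have := mul_le_mul_of_nonneg_left habs (h0 i)
  calc lam i * sortedAbs z i ≤ _ := this
    _ = _ := by ring

end SlopeNorm

section SlopeProx

variable {n : ℕ} {lam : Fin n → ℝ} {γ : ℝ} {u v : Fin n → ℝ}

/-- The proximal point is characterized by `u - v` being a subgradient of `γ‖·‖_λ` at `v`. -/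
theorem isSlopeProx_iff (hlam : Antitone lam) (h0 : ∀ i, 0 ≤ lam i) (hγ : 0 ≤ γ) :
    IsSlopeProx lam γ u v ↔
      ∀ w, ∑ i, (u i - v i) * (w i - v i) ≤ γ * (slopeNorm lam w - slopeNorm lam v) := by
  have expand : ∀ (w : Fin n → ℝ) (t : ℝ), ∑ i, (u i - (v i + t * (w i - v i))) ^ 2 =
      ∑ i, (u i - v i) ^ 2 - 2 * t * ∑ i, (u i - v i) * (w i - v i) +
        t ^ 2 * ∑ i, (w i - v i) ^ 2 := fun w t => by
    simp only [Finset.mul_sum, ← Finset.sum_sub_distrib, ← Finset.sum_add_distrib]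
    exact Finset.sum_congr rfl fun i _ => by ring
  constructor
  · intro h w
    set A := ∑ i, (u i - v i) * (w i - v i)
    set B := ∑ i, (w i - v i) ^ 2
    have key : ∀ t ∈ Set.Ioc (0 : ℝ) 1,
        A ≤ γ * (slopeNorm lam w - slopeNorm lam v) + t * (B / 2) := by
      rintro t ⟨ht0, ht1⟩
      have h1 := h fun i => v i + t * (w i - v i)
      simp only [slopeObj] at h1
      rw [expand w t] at h1
      have h2 := mul_le_mul_of_nonneg_left (slopeNorm_segment_le hlam h0 v w ht0.le ht1) hγ
      refine le_of_mul_le_mul_left ?_ ht0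
      linarith
    have hlim : Tendsto (fun t : ℝ => γ * (slopeNorm lam w - slopeNorm lam v) + t * (B / 2))
        (nhdsWithin 0 (Set.Ioi 0)) (nhds (γ * (slopeNorm lam w - slopeNorm lam v))) := by
      refine Tendsto.mono_left ?_ nhdsWithin_le_nhds
      exact Continuous.tendsto' (by fun_prop) _ _ (by simp)
    refine ge_of_tendsto hlim ?_
    filter_upwards [Ioc_mem_nhdsGT (zero_lt_one' ℝ)] with t ht using key t ht
  · intro h w
    have h1 := expand w 1
    simp only [one_mul, add_sub_cancel] at h1
    have h2 := h w
    have h3 : 0 ≤ ∑ i, (w i - v i) ^ 2 := Finset.sum_nonneg fun i _ => sq_nonneg _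
    simp only [slopeObj]
    rw [h1]
    linarith

theorem IsSlopeProx.sum_sq_sub_le (hlam : Antitone lam) (h0 : ∀ i, 0 ≤ lam i) (hγ : 0 ≤ γ)
    {u' v' : Fin n → ℝ} (h : IsSlopeProx lam γ u v) (h' : IsSlopeProx lam γ u' v') :
    ∑ i, (v i - v' i) ^ 2 ≤ ∑ i, (u i - u' i) ^ 2 := by
  have h1 := (isSlopeProx_iff hlam h0 hγ).1 h v'
  have h2 := (isSlopeProx_iff hlam h0 hγ).1 h' v
  have h3 : ∑ i, (u i - v i) * (v' i - v i) + ∑ i, (u' i - v' i) * (v i - v' i) ≤ 0 := by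
    linarith
  have h4 : 0 ≤ ∑ i, ((u i - u' i) - (v i - v' i)) ^ 2 := Finset.sum_nonneg fun i _ => sq_nonneg _
  have h5 : ∑ i, (u i - u' i) ^ 2 - ∑ i, (v i - v' i) ^ 2 =
      ∑ i, ((u i - u' i) - (v i - v' i)) ^ 2 -
      2 * (∑ i, (u i - v i) * (v' i - v i) + ∑ i, (u' i - v' i) * (v i - v' i)) := by
    simp only [Finset.mul_sum, ← Finset.sum_sub_distrib, ← Finset.sum_add_distrib]
    exact Finset.sum_congr rfl fun i _ => by ring
  linarith

theorem IsSlopeProx.unique (hlam : Antitone lam) (h0 : ∀ i, 0 ≤ lam i) (hγ : 0 ≤ γ)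
    {v' : Fin n → ℝ} (h : IsSlopeProx lam γ u v) (h' : IsSlopeProx lam γ u v') : v = v' := by
  have h1 := h.sum_sq_sub_le hlam h0 hγ h'
  simp only [sub_self, ne_eq, OfNat.ofNat_ne_zero, not_false_eq_true, zero_pow,
    Finset.sum_const_zero] at h1
  have h2 := (Finset.sum_eq_zero_iff_of_nonneg fun i _ => sq_nonneg (v i - v' i)).1
    (le_antisymm h1 (Finset.sum_nonneg fun i _ => sq_nonneg _))
  funext i
  exact sub_eq_zero.1 (pow_eq_zero_iff two_ne_zero |>.1 (h2 i (Finset.mem_univ i)))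

theorem IsSlopeProx.comp_perm (hlam : Antitone lam) (π : Equiv.Perm (Fin n))
    (h : IsSlopeProx lam γ u v) :
    IsSlopeProx lam γ (fun i => u (π i)) (fun i => v (π i)) := fun w => by
  have h1 := h fun i => w (π.symm i)
  have h2 := slopeNorm_comp_perm hlam π.symm w
  have h3 := slopeNorm_comp_perm hlam π v
  have h4 := Equiv.sum_comp π fun i => (u i - v i) ^ 2
  have h5 := Equiv.sum_comp π fun i => (u i - w (π.symm i)) ^ 2
  simp only [Equiv.symm_apply_apply] at h5
  simp only [slopeObj] at h1 ⊢
  rw [h2, ← h5, ← h4, ← h3] at h1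
  exact h1

theorem IsSlopeProx.sum_sq_residual_le (hlam : Antitone lam) (h0 : ∀ i, 0 ≤ lam i) (hγ : 0 ≤ γ)
    (h : IsSlopeProx lam γ u v) : ∑ i, (u i - v i) ^ 2 ≤ γ ^ 2 * ∑ i, lam i ^ 2 := by
  set π := Tuple.sort fun j => -|u j|
  have h1 := (isSlopeProx_iff hlam h0 hγ).1 h u
  have h2 := sum_mul_abs_comp_perm_le_slopeNorm hlam π v
  have h3 : slopeNorm lam u - slopeNorm lam v ≤ ∑ i, lam i * |u (π i) - v (π i)| := by
    have : slopeNorm lam u - ∑ i, lam i * |v (π i)| ≤ ∑ i, lam i * |u (π i) - v (π i)| := by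
      simp only [slopeNorm, ← Finset.sum_sub_distrib]
      refine Finset.sum_le_sum fun i _ => ?_
      rw [← mul_sub]
      exact mul_le_mul_of_nonneg_left (abs_sub_abs_le_abs_sub _ _) (h0 i)
    linarith
  have h4 := mul_le_mul_of_nonneg_left h3 hγ
  have h5 : γ * ∑ i, lam i * |u (π i) - v (π i)| ≤
      ∑ i, ((γ ^ 2 * lam i ^ 2) / 2 + (u (π i) - v (π i)) ^ 2 / 2) := by
    rw [Finset.mul_sum]
    refine Finset.sum_le_sum fun i _ => ?_
    rw [← sq_abs (u (π i) - v (π i))]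
    nlinarith [sq_nonneg (γ * lam i - |u (π i) - v (π i)|)]
  rw [Finset.sum_add_distrib, ← Finset.sum_div, ← Finset.sum_div,
    Equiv.sum_comp π fun i => (u i - v i) ^ 2, ← Finset.mul_sum] at h5
  simp only [← sq] at h1
  linarith

theorem continuous_of_isSlopeProx (hlam : Antitone lam) (h0 : ∀ i, 0 ≤ lam i) (hγ : 0 ≤ γ)
    {f : (Fin n → ℝ) → Fin n → ℝ} (hf : ∀ u, IsSlopeProx lam γ u (f u)) : Continuous f := by
  refine continuous_pi fun j => continuous_iff_continuousAt.2 fun a => ?_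
  rw [ContinuousAt, tendsto_iff_dist_tendsto_zero]
  have hlim : Tendsto (fun u : Fin n → ℝ => √(∑ i, (u i - a i) ^ 2)) (nhds a) (nhds 0) :=
    Continuous.tendsto' (by fun_prop) _ _ (by simp)
  refine squeeze_zero (fun _ => dist_nonneg) (fun u => ?_) hlim
  rw [Real.dist_eq]
  refine Real.abs_le_sqrt (le_trans ?_ ((hf u).sum_sq_sub_le hlam h0 hγ (hf a)))
  exact Finset.single_le_sum (f := fun i => (f u i - f a i) ^ 2)
    (fun i _ => sq_nonneg _) (Finset.mem_univ j)

end SlopeProx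

section Split

variable {k m : ℕ} {lam : Fin (k + m) → ℝ}

/-- The permutation of `Fin (k + m)` fixing the first `k` indices and permuting the others. -/
def permTail (k : ℕ) {m : ℕ} (ρ : Equiv.Perm (Fin m)) : Equiv.Perm (Fin (k + m)) :=
  finSumFinEquiv.symm.trans ((Equiv.sumCongr (Equiv.refl (Fin k)) ρ).trans finSumFinEquiv)

@[simp] theorem permTail_castAdd (ρ : Equiv.Perm (Fin m)) (i : Fin k) :
    permTail k ρ (Fin.castAdd m i) = Fin.castAdd m i := by simp [permTail]

@[simp] theorem permTail_natAdd (ρ : Equiv.Perm (Fin m)) (j : Fin m) :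
    permTail k ρ (Fin.natAdd k j) = Fin.natAdd k (ρ j) := by simp [permTail]

theorem add_slopeNorm_tail_le (hlam : Antitone lam) (w : Fin (k + m) → ℝ) :
    ∑ i : Fin k, lam (Fin.castAdd m i) * |w (Fin.castAdd m i)| +
      slopeNorm (fun j => lam (Fin.natAdd k j)) (fun j => w (Fin.natAdd k j)) ≤
        slopeNorm lam w := by
  have h := sum_mul_abs_comp_perm_le_slopeNorm hlam
    (permTail k (Tuple.sort fun j => -|w (Fin.natAdd k j)|)) w
  simpa [Fin.sum_univ_add, slopeNorm, sortedAbs] using h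

theorem slopeNorm_eq_add_tail (hlam : Antitone lam) {w : Fin (k + m) → ℝ}
    (hhead : Antitone fun i : Fin k => |w (Fin.castAdd m i)|)
    (hsep : ∀ i j, |w (Fin.natAdd k j)| ≤ |w (Fin.castAdd m i)|) :
    slopeNorm lam w = ∑ i : Fin k, lam (Fin.castAdd m i) * |w (Fin.castAdd m i)| +
      slopeNorm (fun j => lam (Fin.natAdd k j)) (fun j => w (Fin.natAdd k j)) := by
  rw [slopeNorm_eq_sum_of_antitone hlam
    (π := permTail k (Tuple.sort fun j => -|w (Fin.natAdd k j)|))]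
  · simp [Fin.sum_univ_add, slopeNorm, sortedAbs]
  · intro a b hab
    induction a using Fin.addCases with
    | left a =>
      induction b using Fin.addCases with
      | left b => simpa using hhead (Fin.le_def.2 (Fin.le_def.1 hab) : a ≤ b)
      | right b => simpa using hsep _ _
    | right a =>
      induction b using Fin.addCases with
      | left b =>
        exfalso
        have := b.isLt
        simp only [Fin.le_def, Fin.val_natAdd, Fin.val_castAdd] at hab
        omega
      | right b =>
        simpa [sortedAbs] using
          antitone_sortedAbs (fun j => w (Fin.natAdd k j)) (by simpa using hab : a ≤ b)

/-- If the first `k` coordinates, soft-thresholded by their own weights, stay ordered and above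
the proximal point of the remaining coordinates, then the prox decouples. -/
theorem isSlopeProx_append (hlam : Antitone lam) (h0 : ∀ i, 0 ≤ lam i) {γ : ℝ} (hγ : 0 ≤ γ)
    {u : Fin (k + m) → ℝ} {s a : Fin k → ℝ} {b : Fin m → ℝ}
    (hb : IsSlopeProx (fun j => lam (Fin.natAdd k j)) γ (fun j => u (Fin.natAdd k j)) b)
    (hs : ∀ i, |s i| = 1)
    (ha : ∀ i, a i = u (Fin.castAdd m i) - γ * lam (Fin.castAdd m i) * s i)
    (hsa : ∀ i, s i * a i = |a i|) (hhead : Antitone fun i => |a i|)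
    (hsep : ∀ i j, |b j| ≤ |a i|) : IsSlopeProx lam γ u (Fin.append a b) := by
  have hlam' : Antitone fun j => lam (Fin.natAdd k j) := fun i j hij =>
    hlam (by simpa using hij)
  rw [isSlopeProx_iff hlam h0 hγ]
  intro w
  have h1 := (isSlopeProx_iff hlam' (fun j => h0 _) hγ).1 hb fun j => w (Fin.natAdd k j)
  have h2 := mul_le_mul_of_nonneg_left (add_slopeNorm_tail_le hlam w) hγ
  have h3 := slopeNorm_eq_add_tail hlam (w := Fin.append a b) (by simpa using hhead)
    (by simpa using hsep)
  simp only [Fin.append_left, Fin.append_right] at h3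
  have h4 : ∑ i : Fin k, (u (Fin.castAdd m i) - a i) * (w (Fin.castAdd m i) - a i) ≤
      γ * (∑ i : Fin k, lam (Fin.castAdd m i) * |w (Fin.castAdd m i)| -
        ∑ i : Fin k, lam (Fin.castAdd m i) * |a i|) := by
    rw [← Finset.sum_sub_distrib, Finset.mul_sum]
    refine Finset.sum_le_sum fun i _ => ?_
    have hw : s i * w (Fin.castAdd m i) ≤ |w (Fin.castAdd m i)| := by
      refine (le_abs_self _).trans_eq ?_
      rw [abs_mul, hs, one_mul]
    have hw' := mul_le_mul_of_nonneg_left hw (mul_nonneg hγ (h0 (Fin.castAdd m i)))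
    rw [← hsa i]
    have : u (Fin.castAdd m i) - a i = γ * lam (Fin.castAdd m i) * s i := by rw [ha]; ring
    rw [this]
    linarith
  rw [Fin.sum_univ_add, h3]
  simp only [Fin.append_left, Fin.append_right]
  linarith

end Split

section Gaussian

instance (n : ℕ) : IsProbabilityMeasure (_root_.stdGaussian n) := by
  unfold _root_.stdGaussian; infer_instance

theorem measurePreserving_eval_stdGaussian {n : ℕ} (i : Fin n) :
    MeasurePreserving (fun h : Fin n → ℝ => h i) (_root_.stdGaussian n) (gaussianReal 0 1) :=
  measurePreserving_eval (fun _ => gaussianReal 0 1) i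

theorem measurePreserving_comp_stdGaussian {m n : ℕ} {e : Fin m → Fin n}
    (he : Function.Injective e) :
    MeasurePreserving (fun (h : Fin n → ℝ) j => h (e j)) (_root_.stdGaussian n)
      (_root_.stdGaussian m) := by
  refine ⟨by fun_prop, ?_⟩
  have hind : iIndepFun (fun (i : Fin n) (h : Fin n → ℝ) => h i) (_root_.stdGaussian n) :=
    iIndepFun_pi (X := fun _ x => x) (fun _ => aemeasurable_id)
  have := (iIndepFun_iff_map_fun_eq_pi_map
    (fun j => (measurable_pi_apply (e j)).aemeasurable)).1 (hind.precomp he)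
  rw [this]
  simp only [(measurePreserving_eval_stdGaussian _).map_eq]
  rfl

theorem integrable_sub_sq_gaussianReal (c : ℝ) :
    Integrable (fun y : ℝ => (y - c) ^ 2) (gaussianReal 0 1) :=
  ((memLp_id_gaussianReal 2).sub (memLp_const c)).integrable_sq

theorem integral_sub_sq_gaussianReal (c : ℝ) :
    ∫ y, (y - c) ^ 2 ∂gaussianReal 0 1 = 1 + c ^ 2 := by
  have hid : MemLp (id : ℝ → ℝ) 2 (gaussianReal 0 1) := memLp_id_gaussianReal 2
  have h1 : Integrable (fun y : ℝ => y) (gaussianReal 0 1) := hid.integrable one_le_two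
  have h2 : Integrable (fun y : ℝ => y ^ 2) (gaussianReal 0 1) := hid.integrable_sq
  have hv : ∫ y, y ^ 2 ∂gaussianReal 0 1 = 1 := by
    have := variance_eq_sub hid
    simpa using this.symm
  have : ∀ y : ℝ, (y - c) ^ 2 = y ^ 2 - 2 * c * y + c ^ 2 := fun y => by ring
  simp_rw [this]
  have h3 : Integrable (fun y : ℝ => 2 * c * y) (gaussianReal 0 1) := h1.const_mul _
  have h4 : Integrable (fun y : ℝ => y ^ 2 - 2 * c * y) (gaussianReal 0 1) := h2.sub h3
  rw [integral_add h4 (integrable_const _), integral_sub h2 h3, integral_const_mul, hv]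
  simp

theorem integrable_eval_sub_sq_stdGaussian {n : ℕ} (i : Fin n) (c : ℝ) :
    Integrable (fun h : Fin n → ℝ => (h i - c) ^ 2) (_root_.stdGaussian n) :=
  (measurePreserving_eval_stdGaussian i).integrable_comp_of_integrable
    (integrable_sub_sq_gaussianReal c)

theorem integral_eval_sub_sq_stdGaussian {n : ℕ} (i : Fin n) (c : ℝ) :
    ∫ h : Fin n → ℝ, (h i - c) ^ 2 ∂_root_.stdGaussian n = 1 + c ^ 2 := by
  rw [← integral_sub_sq_gaussianReal c, ← (measurePreserving_eval_stdGaussian i).map_eq,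
    integral_map (measurable_pi_apply i).aemeasurable (by fun_prop)]

theorem integrable_two_mul_sum_sq_add_const_stdGaussian (n : ℕ) (C : ℝ) :
    Integrable (fun h : Fin n → ℝ => 2 * ∑ i, h i ^ 2 + C) (_root_.stdGaussian n) := by
  refine Integrable.add (Integrable.const_mul (integrable_finsetSum _ fun i _ => ?_) 2)
    (integrable_const C)
  simpa using integrable_eval_sub_sq_stdGaussian i 0

end Gaussian

section LowNoise

variable {k m : ℕ} {x : Fin (k + m) → ℝ}

/-- A nonincreasing vector of absolute values with exactly `k` nonzero entries has its nonzero
entries in front. -/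
theorem ne_zero_castAdd_and_eq_zero_natAdd (hx : Antitone fun i => |x i|)
    (hcard : {i | x i ≠ 0}.ncard = k) :
    (∀ i : Fin k, x (Fin.castAdd m i) ≠ 0) ∧ ∀ j : Fin m, x (Fin.natAdd k j) = 0 := by
  constructor
  · intro i hi
    have hsub : {j | x j ≠ 0} ⊆ (Finset.Iio (Fin.castAdd m i) : Set (Fin (k + m))) := by
      intro j hj
      simp only [Finset.coe_Iio, Set.mem_Iio]
      by_contra! hij
      have := hx hij
      simp only [hi, abs_zero] at this
      exact hj (abs_nonpos_iff.1 this)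
    have := Set.ncard_le_ncard hsub
    rw [Set.ncard_coe_finset, Fin.card_Iio, hcard, Fin.val_castAdd] at this
    omega
  · intro j
    by_contra hj
    have hsub : (Finset.Iic (Fin.natAdd k j) : Set (Fin (k + m))) ⊆ {i | x i ≠ 0} := by
      intro i hi
      simp only [Finset.coe_Iic, Set.mem_Iic] at hi
      have := hx hi
      exact abs_pos.1 ((abs_pos.2 hj).trans_le this)
    have := Set.ncard_le_ncard hsub
    rw [Set.ncard_coe_finset, Fin.card_Iic, hcard, Fin.val_natAdd] at this
    omega

theorem eventually_div_add_ge {a a' b b' : ℝ} (h : a' < a) :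
    ∀ᶠ σ : ℝ in nhdsWithin 0 (Set.Ioi 0), a' / σ + b' ≤ a / σ + b := by
  have h1 := (tendsto_inv_nhdsGT_zero (𝕜 := ℝ)).const_mul_atTop (sub_pos.2 h)
  filter_upwards [h1.eventually_ge_atTop (b' - b)] with σ hσ
  rw [div_eq_mul_inv, div_eq_mul_inv]
  linarith

variable {lam : Fin (k + m) → ℝ} {χ : ℝ} {f : (Fin (k + m) → ℝ) → Fin (k + m) → ℝ}
  {g : (Fin m → ℝ) → Fin m → ℝ}

/-- For a sorted signal and small noise level, the prox shifts each nonzero coordinate by its own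
weight and acts on the zero coordinates through the remaining weights. -/
theorem eventually_slopeProx_eq_append (hlam : Antitone lam) (h0 : ∀ i, 0 ≤ lam i) (hχ : 0 ≤ χ)
    (hg : ∀ u, IsSlopeProx (fun j => lam (Fin.natAdd k j)) χ u (g u))
    (hne : ∀ i : Fin k, x (Fin.castAdd m i) ≠ 0) (hzero : ∀ j : Fin m, x (Fin.natAdd k j) = 0)
    (hanti : StrictAnti fun i : Fin k => |x (Fin.castAdd m i)|) (h : Fin (k + m) → ℝ) :
    ∀ᶠ σ : ℝ in nhdsWithin 0 (Set.Ioi 0), IsSlopeProx lam χ (fun i => x i / σ + h i)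
      (Fin.append (fun i : Fin k => x (Fin.castAdd m i) / σ + h (Fin.castAdd m i) -
          χ * lam (Fin.castAdd m i) * SignType.sign (x (Fin.castAdd m i)))
        (g fun j => h (Fin.natAdd k j))) := by
  set s : Fin k → ℝ := fun i => SignType.sign (x (Fin.castAdd m i)) with hs
  set t : Fin k → ℝ := fun i => s i * h (Fin.castAdd m i) - χ * lam (Fin.castAdd m i) with ht
  have hs1 : ∀ i, |s i| = 1 := fun i => by
    rcases lt_or_gt_of_ne (hne i) with hi | hi <;> simp [hs, hi]
  have hss : ∀ i, s i * s i = 1 := fun i => by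
    rw [← abs_mul_abs_self, hs1, one_mul]
  have hsx : ∀ i, s i * x (Fin.castAdd m i) = |x (Fin.castAdd m i)| := fun i =>
    sign_mul_self _
  have hpos : ∀ᶠ σ : ℝ in nhdsWithin 0 (Set.Ioi 0), ∀ i,
      0 / σ + 0 ≤ |x (Fin.castAdd m i)| / σ + t i :=
    eventually_all.2 fun i => eventually_div_add_ge (abs_pos.2 (hne i))
  have hsep : ∀ᶠ σ : ℝ in nhdsWithin 0 (Set.Ioi 0), ∀ i j,
      0 / σ + |g (fun j => h (Fin.natAdd k j)) j| ≤ |x (Fin.castAdd m i)| / σ + t i :=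
    eventually_all.2 fun i => eventually_all.2 fun j => eventually_div_add_ge (abs_pos.2 (hne i))
  have hord : ∀ᶠ σ : ℝ in nhdsWithin 0 (Set.Ioi 0), ∀ i j, i < j →
      |x (Fin.castAdd m j)| / σ + t j ≤ |x (Fin.castAdd m i)| / σ + t i :=
    eventually_all.2 fun i => eventually_all.2 fun j => eventually_imp_distrib_left.2 fun hij =>
      eventually_div_add_ge (hanti hij)
  filter_upwards [hpos, hsep, hord] with σ hpos hsep hord
  simp only [zero_div, zero_add] at hpos hsep
  set a : Fin k → ℝ := fun i => x (Fin.castAdd m i) / σ + h (Fin.castAdd m i) -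
    χ * lam (Fin.castAdd m i) * s i with ha
  have hsa : ∀ i, s i * a i = |x (Fin.castAdd m i)| / σ + t i := fun i => by
    rw [← hsx i]
    simp only [ha, ht]
    linear_combination (-χ * lam (Fin.castAdd m i)) * hss i
  have habs : ∀ i, |a i| = |x (Fin.castAdd m i)| / σ + t i := fun i => by
    rw [← hsa i, ← abs_of_nonneg ((hpos i).trans_eq (hsa i).symm), abs_mul, hs1, one_mul]
  refine isSlopeProx_append hlam h0 hχ ?_ hs1 (fun i => rfl) (fun i => by rw [hsa, habs]) ?_ ?_
  · simpa [hzero] using hg _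
  · intro i j hij
    rcases hij.eq_or_lt with rfl | hij
    · exact le_rfl
    · simpa only [habs] using hord i j hij
  · simpa only [habs] using hsep

theorem tendsto_integral_slopeProx_sub_sq (hlam : Antitone lam) (h0 : ∀ i, 0 ≤ lam i)
    (hχ : 0 ≤ χ) (hf : ∀ u, IsSlopeProx lam χ u (f u))
    (hg : ∀ u, IsSlopeProx (fun j => lam (Fin.natAdd k j)) χ u (g u))
    (hcard : {i | x i ≠ 0}.ncard = k)
    (hdistinct : ∀ i j, i ≠ j → x i ≠ 0 → x j ≠ 0 → |x i| ≠ |x j|) :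
    Tendsto (fun σ : ℝ =>
        ∫ h, ∑ i, (f (fun j => x j / σ + h j) i - x i / σ) ^ 2 ∂_root_.stdGaussian (k + m))
      (nhdsWithin 0 (Set.Ioi 0))
      (nhds (k + χ ^ 2 * ∑ i : Fin k, lam (Fin.castAdd m i) ^ 2 +
        ∫ h, ∑ j, g h j ^ 2 ∂_root_.stdGaussian m)) := by
  have hlam' : Antitone fun j => lam (Fin.natAdd k j) := fun i j hij =>
    hlam (by simpa using hij)
  have hfc := continuous_of_isSlopeProx hlam h0 hχ hf
  have hgc := continuous_of_isSlopeProx hlam' (fun j => h0 _) hχ hg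
  set π := Tuple.sort fun j => -|x j|
  have hπ : Antitone fun i => |x (π i)| := antitone_sortedAbs x
  have hcardπ : {i | x (π i) ≠ 0}.ncard = k := by
    refine Eq.trans ?_ hcard
    exact Set.ncard_preimage_of_injective_subset_range (s := {i | x i ≠ 0}) π.injective
      (by simp [π.surjective.range_eq])
  obtain ⟨hne, hzero⟩ := ne_zero_castAdd_and_eq_zero_natAdd hπ hcardπ
  have hanti : StrictAnti fun i : Fin k => |x (π (Fin.castAdd m i))| := fun i j hij =>
    lt_of_le_of_ne (hπ (Fin.le_def.2 (Fin.le_def.1 hij.le))) (hdistinct _ _ (by simpa using hij.ne')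
      (hne j) (hne i))
  set c : Fin k → ℝ := fun i => χ * lam (Fin.castAdd m i) *
    SignType.sign (x (π (Fin.castAdd m i))) with hc
  have hc2 : ∀ i, c i ^ 2 = χ ^ 2 * lam (Fin.castAdd m i) ^ 2 := fun i => by
    rcases lt_or_gt_of_ne (hne i) with hi | hi <;> simp [hc, hi, mul_pow]
  have he : Function.Injective fun j : Fin m => π (Fin.natAdd k j) :=
    π.injective.comp (Fin.natAdd_injective m k)
  have hmp := measurePreserving_comp_stdGaussian he
  have hg_le : ∀ u, ∑ j, g u j ^ 2 ≤
      2 * ∑ j, u j ^ 2 + 2 * (χ ^ 2 * ∑ j, lam (Fin.natAdd k j) ^ 2) := fun u => by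
    have h1 := (hg u).sum_sq_residual_le hlam' (fun j => h0 _) hχ
    have h2 : ∑ j, g u j ^ 2 ≤ 2 * ∑ j, u j ^ 2 + 2 * ∑ j, (u j - g u j) ^ 2 := by
      simp only [Finset.mul_sum, ← Finset.sum_add_distrib]
      exact Finset.sum_le_sum fun j _ => by nlinarith [sq_nonneg (2 * u j - g u j)]
    linarith
  have hg_int : Integrable (fun h => ∑ j, g h j ^ 2) (_root_.stdGaussian m) := by
    refine (integrable_two_mul_sum_sq_add_const_stdGaussian m
      (2 * (χ ^ 2 * ∑ j, lam (Fin.natAdd k j) ^ 2))).mono'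
        (by fun_prop) (Eventually.of_forall fun u => ?_)
    exact (Real.norm_of_nonneg (Finset.sum_nonneg fun j _ => sq_nonneg _)).trans_le (hg_le u)
  have hlim : ∫ h, (∑ i : Fin k, (h (π (Fin.castAdd m i)) - c i) ^ 2 +
      ∑ j, g (fun j => h (π (Fin.natAdd k j))) j ^ 2) ∂_root_.stdGaussian (k + m) =
      k + χ ^ 2 * ∑ i : Fin k, lam (Fin.castAdd m i) ^ 2 +
        ∫ h, ∑ j, g h j ^ 2 ∂_root_.stdGaussian m := by
    have hg_int' : Integrable (fun h : Fin (k + m) → ℝ =>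
        ∑ j, g (fun j => h (π (Fin.natAdd k j))) j ^ 2) (_root_.stdGaussian (k + m)) :=
      hmp.integrable_comp_of_integrable hg_int
    rw [integral_add (integrable_finsetSum _ fun i _ => integrable_eval_sub_sq_stdGaussian _ _)
      hg_int',
      integral_finsetSum _ fun i _ => integrable_eval_sub_sq_stdGaussian _ _]
    congr 1
    · simp [integral_eval_sub_sq_stdGaussian, Finset.sum_add_distrib, hc2, Finset.mul_sum]
    · rw [← hmp.map_eq, integral_map hmp.measurable.aemeasurable (by fun_prop)]
  rw [← hlim]
  refine tendsto_integral_filter_of_dominated_convergence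
    (fun h => 2 * ∑ i, h i ^ 2 + 2 * (χ ^ 2 * ∑ i, lam i ^ 2))
    (Eventually.of_forall fun σ => Continuous.aestronglyMeasurable (by fun_prop))
    (Eventually.of_forall fun σ => Eventually.of_forall fun h => ?_)
    (integrable_two_mul_sum_sq_add_const_stdGaussian _ _)
    (Eventually.of_forall fun h => ?_)
  · rw [Real.norm_of_nonneg (Finset.sum_nonneg fun j _ => sq_nonneg _)]
    set u : Fin (k + m) → ℝ := fun j => x j / σ + h j with hu
    have h1 := (hf u).sum_sq_residual_le hlam h0 hχ
    have h2 : ∑ i, (f u i - x i / σ) ^ 2 ≤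
        2 * ∑ i, h i ^ 2 + 2 * ∑ i, (u i - f u i) ^ 2 := by
      simp only [Finset.mul_sum, ← Finset.sum_add_distrib]
      refine Finset.sum_le_sum fun i _ => ?_
      simp only [hu]
      nlinarith [sq_nonneg (h i + (x i / σ + h i - f u i))]
    linarith
  · refine tendsto_nhds_of_eventually_eq ?_
    filter_upwards [eventually_slopeProx_eq_append (x := fun i => x (π i)) hlam h0 hχ hg hne hzero
      hanti fun i => h (π i)] with σ hσ
    have heq := ((hf fun j => x j / σ + h j).comp_perm hlam π).unique hlam h0 hχ hσ
    rw [← Equiv.sum_comp π, Fin.sum_univ_add]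
    congr 1
    · refine Finset.sum_congr rfl fun i _ => ?_
      have := congrFun heq (Fin.castAdd m i)
      simp only [Fin.append_left] at this
      rw [this]
      simp only [hc]
      ring
    · refine Finset.sum_congr rfl fun j _ => ?_
      have := congrFun heq (Fin.natAdd k j)
      simp only [Fin.append_right] at this
      rw [this, hzero]
      simp

end LowNoise

/-- for fixed `χ ≥ 0`,
`lim_{σ → 0⁺} (1/p) E‖η(x/σ + h; χ) − x/σ‖₂²
  = k/p + (χ²/p) Σ_{i≤k} λ_i² + (1/p) E‖η(h̃; χ, λ_{[k+1:p]})‖₂²`. -/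
theorem slope_mse_low_noise_decomposition
    (p k : ℕ) (hp : 1 ≤ p) (hk1 : 1 ≤ k) (hkp : k ≤ p)
    (lam : Fin p → ℝ)
    (hmono : ∀ i j : Fin p, i ≤ j → lam j ≤ lam i)
    (hnonneg : ∀ i, 0 ≤ lam i)
    (x : Fin p → ℝ)
    (hxk : {i : Fin p | x i ≠ 0}.ncard = k)
    (hdistinct : ∀ i j : Fin p, i ≠ j → x i ≠ 0 → x j ≠ 0 → |x i| ≠ |x j|)
    (χ : ℝ) (hχ : 0 ≤ χ)
    (η : ℝ → (Fin p → ℝ) → (Fin p → ℝ))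
    (hη : ∀ γ u, 0 ≤ γ → IsSlopeProx lam γ u (η γ u))
    (lamq : Fin (p - k) → ℝ)
    (hlamq : ∀ i : Fin (p - k), lamq i = lam ⟨k + i.val, by have := i.isLt; omega⟩)
    (ηq : ℝ → (Fin (p - k) → ℝ) → (Fin (p - k) → ℝ))
    (hηq : ∀ γ u, 0 ≤ γ → IsSlopeProx lamq γ u (ηq γ u)) :
    Filter.Tendsto (fun σ : ℝ => (1 / (p : ℝ)) *
        ∫ h, (∑ i, (η χ (fun j => x j / σ + h j) i - x i / σ) ^ 2) ∂ stdGaussian p)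
      (nhdsWithin 0 (Set.Ioi 0))
      (nhds ((k : ℝ) / (p : ℝ)
        + χ ^ 2 / (p : ℝ) * (∑ i : Fin p, if (i : ℕ) < k then lam i ^ 2 else 0)
        + (1 / (p : ℝ)) * ∫ ht, (∑ i, (ηq χ ht i) ^ 2) ∂ stdGaussian (p - k))) := by
  have hpk : p = k + (p - k) := by omega
  have hlamq' : ∀ (i : Fin (p - k)) (h : k + (i : ℕ) < p), lamq i = lam ⟨k + i, h⟩ :=
    fun i _ => hlamq i
  clear hlamq
  generalize p - k = m at *
  subst hpk
  have hlamq : lamq = fun j => lam (Fin.natAdd k j) := funext fun j =>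
    hlamq' j (Fin.natAdd k j).isLt
  subst hlamq
  have h := (tendsto_integral_slopeProx_sub_sq (fun i j hij => hmono i j hij) hnonneg hχ
    (fun u => hη χ u hχ) (fun u => hηq χ u hχ) hxk hdistinct).const_mul (1 / ((k + m : ℕ) : ℝ))
  convert h using 2
  simp only [Fin.sum_univ_add, Fin.val_castAdd, Fin.is_lt, if_true, Fin.val_natAdd,
    not_lt.2 (Nat.le_add_right k _), if_false, Finset.sum_const_zero, add_zero]
  ring
end

section
/- Let p ≥ 1 and let λ = (λ₁,…,λ_p) be nonincreasing nonnegative weights. Then the SLOPE proximal operator is Lipschitz in the regularization parameter with constant ‖λ‖₂: for every u ∈ ℝ^p and all γ₁, γ₂ ≥ 0, ‖η(u; γ₁, λ) − η(u; γ₂, λ)‖₂ ≤ ‖λ‖₂ · |γ₁ − γ₂|, where ‖λ‖₂ = (Σ_{i=1}^p λ_i²)^{1/2}. -/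
open MeasureTheory ProbabilityTheory Filter

/-- Any rearrangement of the absolute values gives at most the SLOPE norm. -/
theorem sum_mul_abs_perm_le_slopeNorm {n : ℕ} {lam : Fin n → ℝ} (hlam : Antitone lam)
    (x : Fin n → ℝ) (σ : Equiv.Perm (Fin n)) :
    ∑ i, lam i * |x (σ i)| ≤ slopeNorm lam x := by
  set τ := Tuple.sort fun j => -|x j| with hτ
  have hanti : Antitone fun i => |x (τ i)| := fun i j hij =>
    neg_le_neg_iff.mp (Tuple.monotone_sort (fun j => -|x j|) hij)
  have hmv : Monovary lam fun i => |x (τ i)| := hlam.monovary hanti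
  have h := hmv.sum_mul_comp_perm_le_sum_mul (σ := σ.trans τ.symm)
  simpa [slopeNorm, sortedAbs, ← hτ] using h

theorem slopeNorm_add_le {n : ℕ} {lam : Fin n → ℝ} (hlam : Antitone lam) (hnonneg : ∀ i, 0 ≤ lam i)
    (x y : Fin n → ℝ) : slopeNorm lam (x + y) ≤ slopeNorm lam x + slopeNorm lam y := by
  set τ := Tuple.sort fun j => -|(x + y) j| with hτ
  calc slopeNorm lam (x + y)
      ≤ ∑ i, lam i * |x (τ i)| + ∑ i, lam i * |y (τ i)| := by
        rw [← Finset.sum_add_distrib]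
        refine Finset.sum_le_sum fun i _ => ?_
        rw [← mul_add]
        exact mul_le_mul_of_nonneg_left (abs_add_le _ _) (hnonneg i)
    _ ≤ _ := add_le_add (sum_mul_abs_perm_le_slopeNorm hlam x τ)
        (sum_mul_abs_perm_le_slopeNorm hlam y τ)

theorem slopeNorm_smul_le {n : ℕ} {lam : Fin n → ℝ} (hlam : Antitone lam) (c : ℝ)
    (x : Fin n → ℝ) : slopeNorm lam (c • x) ≤ |c| * slopeNorm lam x := by
  refine le_trans (le_of_eq ?_) (mul_le_mul_of_nonneg_left
    (sum_mul_abs_perm_le_slopeNorm hlam x (Tuple.sort fun j => -|(c • x) j|)) (abs_nonneg c))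
  rw [slopeNorm, Finset.mul_sum]
  refine Finset.sum_congr rfl fun i _ => ?_
  simp only [sortedAbs, Pi.smul_apply, smul_eq_mul, abs_mul]
  ring

theorem slopeNorm_le_sqrt_mul_sqrt {n : ℕ} (lam x : Fin n → ℝ) :
    slopeNorm lam x ≤ √(∑ i, lam i ^ 2) * √(∑ i, x i ^ 2) := by
  refine (Real.sum_mul_le_sqrt_mul_sqrt _ _ _).trans_eq ?_
  simp only [sortedAbs, sq_abs]
  rw [Equiv.sum_comp (Tuple.sort fun j => -|x j|) fun i => x i ^ 2]

theorem abs_slopeNorm_sub_le {n : ℕ} {lam : Fin n → ℝ} (hlam : Antitone lam)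
    (hnonneg : ∀ i, 0 ≤ lam i) (x y : Fin n → ℝ) :
    |slopeNorm lam x - slopeNorm lam y| ≤ slopeNorm lam (x - y) := by
  have hx := slopeNorm_add_le hlam hnonneg (x - y) y
  have hy := slopeNorm_add_le hlam hnonneg (y - x) x
  have hneg := slopeNorm_smul_le hlam (-1) (x - y)
  rw [sub_add_cancel] at hx hy
  rw [neg_one_smul, neg_sub, abs_neg, abs_one, one_mul] at hneg
  rw [abs_le]
  constructor <;> linarith

/-- The variational inequality satisfied by the SLOPE proximal point. -/
theorem IsSlopeProx.sum_mul_le {n : ℕ} {lam : Fin n → ℝ} {γ : ℝ} {u v : Fin n → ℝ}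
    (hv : IsSlopeProx lam γ u v) (hlam : Antitone lam) (hnonneg : ∀ i, 0 ≤ lam i) (hγ : 0 ≤ γ)
    (w : Fin n → ℝ) :
    ∑ i, (u i - v i) * (w i - v i) ≤ γ * (slopeNorm lam w - slopeNorm lam v) := by
  set A := ∑ i, (u i - v i) * (w i - v i) - γ * (slopeNorm lam w - slopeNorm lam v) with hA
  set B := ∑ i, (w i - v i) ^ 2 with hB
  have hB0 : 0 ≤ B := Finset.sum_nonneg fun i _ => sq_nonneg _
  have key : ∀ t : ℝ, 0 < t → t ≤ 1 → A ≤ t / 2 * B := by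
    intro t ht ht1
    have hmin := hv ((1 - t) • v + t • w)
    have hconv : slopeNorm lam ((1 - t) • v + t • w)
        ≤ (1 - t) * slopeNorm lam v + t * slopeNorm lam w := by
      have h1 := slopeNorm_smul_le hlam (1 - t) v
      have h2 := slopeNorm_smul_le hlam t w
      rw [abs_of_nonneg (sub_nonneg.mpr ht1)] at h1
      rw [abs_of_pos ht] at h2
      linarith [slopeNorm_add_le hlam hnonneg ((1 - t) • v) (t • w)]
    have hsq : ∑ i, (u i - ((1 - t) • v + t • w) i) ^ 2
        = ∑ i, (u i - v i) ^ 2 - 2 * t * ∑ i, (u i - v i) * (w i - v i) + t ^ 2 * B := by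
      rw [hB, Finset.mul_sum, Finset.mul_sum, ← Finset.sum_sub_distrib, ← Finset.sum_add_distrib]
      refine Finset.sum_congr rfl fun i _ => ?_
      simp only [Pi.add_apply, Pi.smul_apply, smul_eq_mul]
      ring
    rw [slopeObj, slopeObj, hsq] at hmin
    have hγconv := mul_le_mul_of_nonneg_left hconv hγ
    refine le_of_mul_le_mul_left ?_ ht
    rw [hA]
    linarith
  by_contra! hlt
  have hApos : 0 < A := sub_pos.mpr hlt
  have hAB : 0 < A + B := by linarith
  have h := key (A / (A + B)) (div_pos hApos hAB) ((div_le_one hAB).mpr (by linarith))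
  rw [div_div, div_mul_eq_mul_div, le_div_iff₀ (by linarith)] at h
  have := le_of_mul_le_mul_left h hApos
  linarith

/-- the SLOPE proximal operator is `‖λ‖₂`-Lipschitz in the tuning
parameter: `‖η(u;γ₁) − η(u;γ₂)‖₂ ≤ ‖λ‖₂ |γ₁ − γ₂|`. -/
theorem slope_prox_lipschitz_in_gamma
    (p : ℕ) (hp : 1 ≤ p)
    (lam : Fin p → ℝ)
    (hmono : ∀ i j : Fin p, i ≤ j → lam j ≤ lam i)
    (hnonneg : ∀ i, 0 ≤ lam i)
    (γ₁ γ₂ : ℝ) (hγ₁ : 0 ≤ γ₁) (hγ₂ : 0 ≤ γ₂)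
    (u v₁ v₂ : Fin p → ℝ)
    (hv₁ : IsSlopeProx lam γ₁ u v₁) (hv₂ : IsSlopeProx lam γ₂ u v₂) :
    Real.sqrt (∑ i, (v₁ i - v₂ i) ^ 2)
      ≤ Real.sqrt (∑ i, lam i ^ 2) * |γ₁ - γ₂| := by
  have hlam : Antitone lam := fun i j hij => hmono i j hij
  set D := √(∑ i, (v₁ i - v₂ i) ^ 2) with hD
  set L := √(∑ i, lam i ^ 2)
  have hsq : D * D ≤ L * |γ₁ - γ₂| * D :=
    calc D * D = ∑ i, (u i - v₁ i) * (v₂ i - v₁ i) + ∑ i, (u i - v₂ i) * (v₁ i - v₂ i) := by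
          rw [hD, Real.mul_self_sqrt (Finset.sum_nonneg fun i _ => sq_nonneg _),
            ← Finset.sum_add_distrib]
          exact Finset.sum_congr rfl fun i _ => by ring
      _ ≤ γ₁ * (slopeNorm lam v₂ - slopeNorm lam v₁)
          + γ₂ * (slopeNorm lam v₁ - slopeNorm lam v₂) :=
          add_le_add (hv₁.sum_mul_le hlam hnonneg hγ₁ v₂) (hv₂.sum_mul_le hlam hnonneg hγ₂ v₁)
      _ = -((γ₁ - γ₂) * (slopeNorm lam v₁ - slopeNorm lam v₂)) := by ring
      _ ≤ |γ₁ - γ₂| * |slopeNorm lam v₁ - slopeNorm lam v₂| := by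
          rw [← abs_mul]
          exact neg_le_abs _
      _ ≤ |γ₁ - γ₂| * (L * D) :=
          mul_le_mul_of_nonneg_left ((abs_slopeNorm_sub_le hlam hnonneg v₁ v₂).trans
            (slopeNorm_le_sqrt_mul_sqrt lam (v₁ - v₂))) (abs_nonneg _)
      _ = L * |γ₁ - γ₂| * D := by ring
  rcases (show 0 ≤ D from Real.sqrt_nonneg _).eq_or_lt with h0 | hpos
  · rw [← h0]
    positivity
  · exact le_of_mul_le_mul_right hsq hpos
end
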